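/- Let ψ be a flow on a metric space (X,d) such that ψ_t is Lipschitz continuous for every t ≥ 0, uniformly for t in compact subsets of [0,+∞). Then ψ is strongly chain recurrent if and only if every Lipschitz continuous Lyapunov function for ψ is a first integral. -/

import Mathlib

/-- A (continuous) flow on a metric space. -/
def IsFlow {X : Type*} [MetricSpace X] (ψ : ℝ → X → X) : Prop :=
  Continuous (fun p : ℝ × X => ψ p.1 p.2) ∧ (∀ x, ψ 0 x = x) ∧
    ∀ t s x, ψ (t + s) x = ψ t (ψ s x)

/-- There is a strong `(ε,T)`-chain from `a` to `b`: a finite sequence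
`(x_i, t_i)`, `i = 1, …, n` with `t_i ≥ T`, `x_1 = a`, `x_{n+1} = b`, and
`∑ d(ψ_{t_i}(x_i), x_{i+1}) < ε`. -/
def HasStrongChain {X : Type*} [MetricSpace X] (ψ : ℝ → X → X) (ε T : ℝ) (a b : X) : Prop :=
  ∃ (n : ℕ) (x : Fin (n + 1) → X) (t : Fin n → ℝ), 0 < n ∧ (∀ i, T ≤ t i) ∧
    x 0 = a ∧ x (Fin.last n) = b ∧
    (∑ i : Fin n, dist (ψ (t i) (x i.castSucc)) (x i.succ)) < ε

/-- A strongly chain recurrent point. -/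
def StronglyChainRecurrentPt {X : Type*} [MetricSpace X] (ψ : ℝ → X → X) (x : X) : Prop :=
  ∀ ε > 0, ∀ T ≥ (0 : ℝ), HasStrongChain ψ ε T x x

/-- A Lyapunov function for the flow `ψ`. -/
def IsLyapunov {X : Type*} [MetricSpace X] (ψ : ℝ → X → X) (h : X → ℝ) : Prop :=
  ∀ t ≥ (0 : ℝ), ∀ x, h (ψ t x) ≤ h x

/-- The neutral set of a Lyapunov function. -/
def NeutralSet {X : Type*} [MetricSpace X] (ψ : ℝ → X → X) (h : X → ℝ) : Set X :=
  {x | ∀ t : ℝ, h (ψ t x) = h x}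

/-- A first integral for the flow `ψ`. -/
def IsFirstIntegral {X : Type*} [MetricSpace X] (ψ : ℝ → X → X) (h : X → ℝ) : Prop :=
  ∀ (t : ℝ) (x : X), h (ψ t x) = h x

/-- `ψ_t` is Lipschitz for every `t ≥ 0`, uniformly for `t` in compact subsets
of `[0, +∞)`. -/
def UniformlyLipschitzTimeMaps {X : Type*} [MetricSpace X] (ψ : ℝ → X → X) : Prop :=
  ∀ T ≥ (0 : ℝ), ∃ C : NNReal, ∀ t ∈ Set.Icc 0 T, LipschitzWith C (ψ t)

/-- The flow `ψ` is strongly chain transitive. -/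
def StronglyChainTransitive {X : Type*} [MetricSpace X] (ψ : ℝ → X → X) : Prop :=
  ∀ x y : X, ∀ ε > 0, ∀ T ≥ (0 : ℝ), HasStrongChain ψ ε T x y

section StrongChains

variable {X : Type*} [MetricSpace X] {ψ : ℝ → X → X}

theorem HasStrongChain.pos {ε T : ℝ} {a b : X} (h : HasStrongChain ψ ε T a b) : 0 < ε := by
  obtain ⟨n, x, t, -, -, -, -, hsum⟩ := h
  exact (Finset.sum_nonneg fun _ _ => dist_nonneg).trans_lt hsum

theorem HasStrongChain.mono {ε ε' T : ℝ} {a b : X} (h : HasStrongChain ψ ε T a b)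
    (hε : ε ≤ ε') : HasStrongChain ψ ε' T a b := by
  obtain ⟨n, x, t, hn, ht, h0, h1, hsum⟩ := h
  exact ⟨n, x, t, hn, ht, h0, h1, hsum.trans_le hε⟩

theorem hasStrongChain_of_dist_lt {ε T s : ℝ} {a b : X} (hs : T ≤ s)
    (h : dist (ψ s a) b < ε) : HasStrongChain ψ ε T a b :=
  ⟨1, ![a, b], fun _ => s, one_pos, fun _ => hs, rfl, rfl, by simpa using h⟩

/-- Moving the endpoint of a chain costs at most the distance moved. -/
theorem HasStrongChain.move_end {ε T : ℝ} {a b c : X} (h : HasStrongChain ψ ε T a b) :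
    HasStrongChain ψ (ε + dist b c) T a c := by
  obtain ⟨n, x, t, hn, ht, rfl, rfl, hsum⟩ := h
  obtain ⟨m, rfl⟩ := Nat.exists_eq_succ_of_ne_zero hn.ne'
  refine ⟨m + 1, Fin.snoc (fun i => x i.castSucc) c, t, hn, ht, ?_, Fin.snoc_last _ _, ?_⟩
  · exact Fin.snoc_castSucc (α := fun _ => X) c (fun i => x i.castSucc) 0
  · rw [Fin.sum_univ_castSucc] at hsum ⊢
    simp only [Fin.succ_castSucc, Fin.snoc_castSucc, Fin.succ_last, Fin.snoc_last] at hsum ⊢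
    linarith [dist_triangle (ψ (t (Fin.last m)) (x (Fin.last m).castSucc))
      (x (Fin.last (m + 1))) c]

/-- Flowing the endpoint of a chain for a time at least `T` is free. -/
theorem HasStrongChain.flow_end {ε T s : ℝ} {a b : X} (h : HasStrongChain ψ ε T a b)
    (hs : T ≤ s) : HasStrongChain ψ ε T a (ψ s b) := by
  obtain ⟨n, x, t, hn, ht, rfl, rfl, hsum⟩ := h
  refine ⟨n + 1, Fin.snoc x (ψ s (x (Fin.last n))), Fin.snoc t s, n.succ_pos, ?_, ?_,
    Fin.snoc_last _ _, ?_⟩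
  · intro i
    induction i using Fin.lastCases with
    | last => simpa using hs
    | cast i => simpa using ht i
  · exact Fin.snoc_castSucc (α := fun _ => X) _ x 0
  · rw [Fin.sum_univ_castSucc]
    simpa only [Fin.succ_castSucc, Fin.snoc_castSucc, Fin.succ_last, Fin.snoc_last,
      dist_self, add_zero] using hsum

theorem IsLyapunov.antitone {h : X → ℝ} (hψ : IsFlow ψ) (hh : IsLyapunov ψ h) (x : X) {s t : ℝ}
    (hst : s ≤ t) : h (ψ t x) ≤ h (ψ s x) := by
  simpa [← hψ.2.2] using hh (t - s) (sub_nonneg.2 hst) (ψ s x)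

/-- A Lipschitz Lyapunov function increases along a strong chain by at most the Lipschitz
constant times the total length of the jumps. -/
theorem IsLyapunov.le_of_hasStrongChain {h : X → ℝ} {K : NNReal} {ε T : ℝ} {a b : X}
    (hψ : IsFlow ψ) (hh : IsLyapunov ψ h) (hK : LipschitzWith K h) (hT : 0 ≤ T)
    (hc : HasStrongChain ψ ε T a b) : h b ≤ h (ψ T a) + K * ε := by
  obtain ⟨n, x, t, hn, ht, rfl, rfl, hsum⟩ := hc
  obtain ⟨m, rfl⟩ := Nat.exists_eq_succ_of_ne_zero hn.ne'
  have jump (y z : X) : h z ≤ h y + K * dist y z := by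
    simpa [dist_comm] using hK.le_add_mul z y
  suffices H : ∀ (m : ℕ) (x : Fin (m + 1 + 1) → X) (t : Fin (m + 1) → ℝ), (∀ i, T ≤ t i) →
      h (x (Fin.last _)) ≤
        h (ψ T (x 0)) + K * ∑ i, dist (ψ (t i) (x i.castSucc)) (x i.succ) from
    (H m x t ht).trans (by gcongr)
  clear hsum ht hn x t m
  intro m
  induction m with
  | zero =>
    intro x t ht
    have h1 := jump (ψ (t 0) (x 0)) (x 1)
    have h2 := hh.antitone hψ (x 0) (ht 0)
    rw [Fin.sum_univ_castSucc, Finset.univ_eq_empty, Finset.sum_empty]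
    change h (x 1) ≤ h (ψ T (x 0)) + K * (0 + dist (ψ (t 0) (x 0)) (x 1))
    linarith
  | succ m ih =>
    intro x t ht
    have h1 := ih (fun i => x i.castSucc) (fun i => t i.castSucc) fun i => ht _
    have h2 := jump (ψ (t (Fin.last _)) (x (Fin.last _).castSucc)) (x (Fin.last _))
    have h3 := hh _ (hT.trans (ht (Fin.last _))) (x (Fin.last _).castSucc)
    rw [Fin.sum_univ_castSucc, mul_add, Fin.succ_last]
    simp only [Fin.succ_castSucc, Fin.castSucc_zero] at h1 ⊢
    linarith

/-- The infimal total length of the jumps of a strong chain with times at least `T`. -/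
noncomputable def strongChainCost (ψ : ℝ → X → X) (T : ℝ) (a b : X) : ℝ :=
  sInf {ε | HasStrongChain ψ ε T a b}

theorem bddBelow_hasStrongChain (T : ℝ) (a b : X) :
    BddBelow {ε | HasStrongChain ψ ε T a b} :=
  ⟨0, fun _ h => h.pos.le⟩

theorem strongChainCost_le {ε T : ℝ} {a b : X} (h : HasStrongChain ψ ε T a b) :
    strongChainCost ψ T a b ≤ ε :=
  csInf_le (bddBelow_hasStrongChain T a b) h

theorem nonempty_hasStrongChain (T : ℝ) (a b : X) :
    {ε | HasStrongChain ψ ε T a b}.Nonempty :=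
  ⟨dist (ψ T a) b + 1, hasStrongChain_of_dist_lt le_rfl (lt_add_one _)⟩

theorem hasStrongChain_of_cost_lt {ε T : ℝ} {a b : X} (h : strongChainCost ψ T a b < ε) :
    HasStrongChain ψ ε T a b := by
  obtain ⟨δ, hδ, hlt⟩ := exists_lt_of_csInf_lt (nonempty_hasStrongChain T a b) h
  exact HasStrongChain.mono hδ hlt.le

theorem strongChainCost_le_dist {T s : ℝ} (hs : T ≤ s) (a b : X) :
    strongChainCost ψ T a b ≤ dist (ψ s a) b :=
  le_of_forall_pos_le_add fun _ hδ =>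
    strongChainCost_le (hasStrongChain_of_dist_lt hs (lt_add_of_pos_right _ hδ))

theorem strongChainCost_le_add_dist (T : ℝ) (a b c : X) :
    strongChainCost ψ T a c ≤ strongChainCost ψ T a b + dist b c :=
  le_of_forall_pos_le_add fun δ hδ => by
    have h := hasStrongChain_of_cost_lt (lt_add_of_pos_right (strongChainCost ψ T a b) hδ)
    have := strongChainCost_le (h.move_end (c := c))
    linarith

theorem strongChainCost_flow_le {T s : ℝ} (hs : T ≤ s) (a b : X) :
    strongChainCost ψ T a (ψ s b) ≤ strongChainCost ψ T a b :=
  le_of_forall_pos_le_add fun _ hδ =>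
    strongChainCost_le ((hasStrongChain_of_cost_lt (lt_add_of_pos_right _ hδ)).flow_end hs)

/-- The supremum of `strongChainCost ψ T a` along the forward orbit of a point. -/
noncomputable def orbitCost (ψ : ℝ → X → X) (T : ℝ) (a y : X) : ℝ :=
  ⨆ s : Set.Ici (0 : ℝ), strongChainCost ψ T a (ψ s y)

theorem bddAbove_orbitCost (hψ : IsFlow ψ) (T : ℝ) (a y : X) :
    BddAbove (Set.range fun s : Set.Ici (0 : ℝ) => strongChainCost ψ T a (ψ s y)) := by
  have hcont : Continuous fun s => dist (ψ T a) (ψ s y) :=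
    continuous_const.dist (hψ.1.comp (Continuous.prodMk_left y))
  obtain ⟨M, hM⟩ := (isCompact_Icc (a := (0 : ℝ)) (b := T)).bddAbove_image hcont.continuousOn
  refine ⟨max M (strongChainCost ψ T a y), ?_⟩
  rintro _ ⟨⟨s, hs⟩, rfl⟩
  rcases le_total s T with hsT | hsT
  · exact le_max_of_le_left <| (strongChainCost_le_dist le_rfl _ _).trans <|
      hM (Set.mem_image_of_mem _ ⟨hs, hsT⟩)
  · exact le_max_of_le_right (strongChainCost_flow_le hsT _ _)

theorem le_orbitCost (hψ : IsFlow ψ) (T : ℝ) (a y : X) {s : ℝ} (hs : 0 ≤ s) :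
    strongChainCost ψ T a (ψ s y) ≤ orbitCost ψ T a y :=
  le_ciSup (bddAbove_orbitCost hψ T a y) ⟨s, hs⟩

theorem orbitCost_le {T c : ℝ} {a y : X}
    (h : ∀ s, 0 ≤ s → strongChainCost ψ T a (ψ s y) ≤ c) : orbitCost ψ T a y ≤ c :=
  ciSup_le fun s => h s s.2

theorem isLyapunov_orbitCost (hψ : IsFlow ψ) (T : ℝ) (a : X) :
    IsLyapunov ψ (orbitCost ψ T a) := by
  intro t ht x
  refine orbitCost_le fun s hs => ?_
  rw [← hψ.2.2]
  exact le_orbitCost hψ T a x (add_nonneg hs ht)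

theorem exists_lipschitzWith_orbitCost (hψ : IsFlow ψ) (hL : UniformlyLipschitzTimeMaps ψ)
    {T : ℝ} (hT : 0 ≤ T) (a : X) : ∃ K : NNReal, LipschitzWith K (orbitCost ψ T a) := by
  obtain ⟨C, hC⟩ := hL T hT
  refine ⟨C, LipschitzWith.of_le_add_mul C fun y z => orbitCost_le fun s hs => ?_⟩
  have key (r : ℝ) (hr : r ∈ Set.Icc 0 T) :
      strongChainCost ψ T a (ψ r y) ≤ orbitCost ψ T a z + C * dist y z := by
    have h1 := strongChainCost_le_add_dist (ψ := ψ) T a (ψ r z) (ψ r y)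
    have h2 := (hC r hr).dist_le_mul z y
    rw [dist_comm z y] at h2
    linarith [le_orbitCost hψ T a z hr.1]
  rcases le_total s T with hsT | hsT
  · exact key s ⟨hs, hsT⟩
  · refine (strongChainCost_flow_le hsT a y).trans ?_
    simpa [hψ.2.1] using key 0 ⟨le_rfl, hT⟩

end StrongChains

theorem SCR_iff_lipschitz_lyapunov_first_integral {X : Type*} [MetricSpace X]
    (ψ : ℝ → X → X) (hψ : IsFlow ψ) (hLipFlow : UniformlyLipschitzTimeMaps ψ) :
    (∀ x, StronglyChainRecurrentPt ψ x) ↔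
      ∀ h : X → ℝ, (∃ K : NNReal, LipschitzWith K h) → IsLyapunov ψ h →
        IsFirstIntegral ψ h := by
  constructor
  · rintro hrec h ⟨K, hK⟩ hh
    have forward (t : ℝ) (ht : 0 ≤ t) (x : X) : h (ψ t x) = h x := by
      refine le_antisymm (hh t ht x) (le_of_forall_pos_le_add fun δ hδ => ?_)
      have hK1 : (0 : ℝ) < K + 1 := by positivity
      refine (hh.le_of_hasStrongChain hψ hK ht (hrec x (δ / (K + 1)) (by positivity) t ht)).trans ?_
      gcongr
      rw [mul_div_assoc', div_le_iff₀ hK1]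
      linarith
    intro t x
    rcases le_total 0 t with ht | ht
    · exact forward t ht x
    · simpa [← hψ.2.2, hψ.2.1] using (forward (-t) (neg_nonneg.2 ht) (ψ t x)).symm
  · intro hfi x ε hε T hT
    apply hasStrongChain_of_cost_lt
    refine lt_of_le_of_lt ?_ hε
    calc strongChainCost ψ T x x = strongChainCost ψ T x (ψ 0 x) := by rw [hψ.2.1]
      _ ≤ orbitCost ψ T x x := le_orbitCost hψ T x x le_rfl
      _ = orbitCost ψ T x (ψ T x) :=
        (hfi _ (exists_lipschitzWith_orbitCost hψ hLipFlow hT x)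
          (isLyapunov_orbitCost hψ T x) T x).symm
      _ ≤ 0 := orbitCost_le fun s hs => by
        rw [← hψ.2.2]
        exact (strongChainCost_le_dist (le_add_of_nonneg_left hs) x _).trans_eq (dist_self _)
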